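/- For every instance with n ≥ 2 agents having nonnegative additive valuations normalized so that v_i(M) = 1, there exists an allocation X = (X_u)_{u∈V_2} to V_2 satisfying (P1). -/

import Mathlib

open Finset
open scoped Classical

noncomputable section

variable {G : Type*}

/-- Value of a bundle under an additive valuation. -/
def val (v : G → ℝ) (S : Finset G) : ℝ := ∑ g ∈ S, v g

/-- Minimum value of a good in a bundle; `0` for the empty bundle. -/
def minval (v : G → ℝ) (S : Finset G) : ℝ :=
  if h : S.Nonempty then S.inf' h v else 0

/-- `X` is a partition of the goods into `n` pairwise disjoint (possibly empty) bundles. -/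
def IsAlloc {n : ℕ} (X : Fin n → Finset G) : Prop :=
  (∀ i j : Fin n, i ≠ j → Disjoint (X i) (X j)) ∧ (∀ g : G, ∃ i : Fin n, g ∈ X i)

/-- Agent `i` is PROPavg-satisfied by the allocation `X`. -/
def PROPavgSat {n : ℕ} (v : Fin n → G → ℝ) (X : Fin n → Finset G) (i : Fin n) : Prop :=
  val (v i) (X i) + (1 / ((n : ℝ) - 1)) * ∑ k ∈ Finset.univ.erase i, minval (v i) (X k)
    ≥ 1 / (n : ℝ)

/-- Edge of the PROPavg-graph between agent `i ∈ V₁` and label `u ∈ V₂` (both parts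
are indexed by `Fin n`, `r` is the distinguished element of `V₂`). -/
def Edge {n : ℕ} (v : Fin n → G → ℝ) (X : Fin n → Finset G) (r i u : Fin n) : Prop :=
  val (v i) (X u) + (1 / ((n : ℝ) - 1)) *
      ∑ u' ∈ (Finset.univ.erase r).erase u, minval (v i) (X u')
    ≥ 1 / (n : ℝ)

/-- `i` is one of the agents `1, …, n-1`, i.e. not the last agent. -/
def InV1 {n : ℕ} (i : Fin n) : Prop := (i : ℕ) < n - 1

/-- The set `V₁` of the first `n-1` agents. -/
def V1 (n : ℕ) : Finset (Fin n) := Finset.univ.filter fun i => (i : ℕ) < n - 1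

/-- A perfect matching of `V₁` onto `V₂ \ {u}` in the PROPavg-graph `G_X`,
i.e. a bijection from `V₁` to `V₂ \ {u}` all of whose pairs are edges. -/
def IsPM {n : ℕ} (v : Fin n → G → ℝ) (X : Fin n → Finset G) (r u : Fin n)
    (f : Fin n → Fin n) : Prop :=
  Set.InjOn f {i : Fin n | InV1 i} ∧
  (∀ i : Fin n, InV1 i → f i ≠ u ∧ Edge v X r i (f i)) ∧
  (∀ w : Fin n, w ≠ u → ∃ i : Fin n, InV1 i ∧ f i = w)

/-- Property (P1): `G_X - r` has a perfect matching. -/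
def P1 {n : ℕ} (v : Fin n → G → ℝ) (X : Fin n → Finset G) (r : Fin n) : Prop :=
  ∃ f : Fin n → Fin n, IsPM v X r r f

/-- Property (P2): for every `u ∈ V₂`, `G_X - u` has a perfect matching. -/
def P2 {n : ℕ} (v : Fin n → G → ℝ) (X : Fin n → Finset G) (r : Fin n) : Prop :=
  ∀ u : Fin n, ∃ f : Fin n → Fin n, IsPM v X r u f

/-- The neighborhood `Γ_{G_X}(S) ⊆ V₂` of a set `S ⊆ V₁` in the PROPavg-graph. -/
def Nbr {n : ℕ} (v : Fin n → G → ℝ) (X : Fin n → Finset G) (r : Fin n)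
    (S : Finset (Fin n)) : Finset (Fin n) :=
  Finset.univ.filter fun u => ∃ i ∈ S, Edge v X r i u

/-- The allocation obtained from `X` by moving the good `g ∈ X ustar` to `X r`. -/
def move {n : ℕ} [DecidableEq G] (X : Fin n → Finset G) (r ustar : Fin n) (g : G) :
    Fin n → Finset G :=
  fun u => if u = r then insert g (X r) else if u = ustar then (X ustar).erase g else X u

theorem val_mono {w : G → ℝ} (hw : ∀ g, 0 ≤ w g) {S T : Finset G} (h : S ⊆ T) :
    val w S ≤ val w T :=
  Finset.sum_le_sum_of_subset_of_nonneg h fun g _ _ => hw g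

theorem val_nonneg {w : G → ℝ} (hw : ∀ g, 0 ≤ w g) (S : Finset G) : 0 ≤ val w S :=
  Finset.sum_nonneg fun g _ => hw g

theorem minval_nonneg {w : G → ℝ} (hw : ∀ g, 0 ≤ w g) (S : Finset G) : 0 ≤ minval w S := by
  unfold minval
  split_ifs with h
  · exact Finset.le_inf' h _ fun g _ => hw g
  · exact le_rfl

theorem val_le_add_minval {w : G → ℝ} {S : Finset G} {a : ℝ} (ha : 0 ≤ a)
    (h : ∀ g ∈ S, val w (S.erase g) ≤ a) : val w S ≤ a + minval w S := by
  by_cases hS : S.Nonempty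
  · obtain ⟨g, hg, hmin⟩ := Finset.exists_mem_eq_inf' hS w
    have hsum : val w (S.erase g) + w g = val w S := Finset.sum_erase_add S w hg
    have hval : minval w S = w g := by rw [minval, dif_pos hS, hmin]
    linarith [h g hg]
  · rw [Finset.not_nonempty_iff_eq_empty] at hS
    simpa [hS, _root_.val, minval] using ha

/-- The bundle of `u` in the allocation giving each good `g` to `c g`. -/
def bundle {ι : Type*} [Fintype G] (c : G → ι) (u : ι) : Finset G :=
  Finset.univ.filter fun g => c g = u

theorem mem_bundle {ι : Type*} [Fintype G] {c : G → ι} {u : ι} {g : G} :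
    g ∈ bundle c u ↔ c g = u := by simp [bundle]

theorem sum_val_bundle {ι : Type*} [Fintype G] [Fintype ι] (w : G → ℝ) (c : G → ι) :
    ∑ u, val w (bundle c u) = val w Finset.univ :=
  Finset.sum_fiberwise Finset.univ c w

theorem isAlloc_bundle [Fintype G] {n : ℕ} (c : G → Fin n) : IsAlloc (bundle c) := by
  refine ⟨fun i j hij => Finset.disjoint_left.2 fun g hi hj => hij ?_, fun g => ⟨c g, ?_⟩⟩
  · exact (mem_bundle.1 hi).symm.trans (mem_bundle.1 hj)
  · exact mem_bundle.2 rfl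

/-- Envy-freeness up to any good between the agents other than `r`. -/
def EFXOff {ι : Type*} [Fintype G] (w : ι → G → ℝ) (r : ι) (c : G → ι) : Prop :=
  ∀ u, u ≠ r → ∀ k, k ≠ r → ∀ g ∈ bundle c k,
    val (w u) ((bundle c k).erase g) ≤ val (w u) (bundle c u)

/-- If some agent envies the bundle of `r`, then giving an agent a minimal envied subset of that
bundle improves the allocation while preserving envy-freeness up to any good. -/
theorem EFXOff.exists_improvement {ι : Type*} [Fintype G] [Fintype ι] {w : ι → G → ℝ} {r : ι}
    {c : G → ι} (hc : EFXOff w r c)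
    (henvy : ∃ u, u ≠ r ∧ val (w u) (bundle c u) < val (w u) (bundle c r)) :
    ∃ c' : G → ι, EFXOff w r c' ∧
      ∑ u ∈ Finset.univ.erase r, val (w u) (bundle c u) <
        ∑ u ∈ Finset.univ.erase r, val (w u) (bundle c' u) := by
  obtain ⟨u₀, hu₀, hlt₀⟩ := henvy
  let E : Finset (Finset G) := (bundle c r).powerset.filter fun Z =>
    ∃ u, u ≠ r ∧ val (w u) (bundle c u) < val (w u) Z
  have hE : E.Nonempty := ⟨bundle c r, by
    simpa [E] using ⟨u₀, hu₀, hlt₀⟩⟩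
  obtain ⟨Z, hZE, hZmin⟩ := Finset.exists_min_image E Finset.card hE
  obtain ⟨hZr, u, hu, hlt⟩ : Z ⊆ bundle c r ∧
      ∃ u, u ≠ r ∧ val (w u) (bundle c u) < val (w u) Z := by simpa [E] using hZE
  have hZ : ∀ j, j ≠ r → ∀ g ∈ Z, val (w j) (Z.erase g) ≤ val (w j) (bundle c j) := by
    intro j hj g hg
    by_contra! hcon
    have hmem : Z.erase g ∈ E := by
      simp only [E, Finset.mem_filter, Finset.mem_powerset]
      exact ⟨(Finset.erase_subset g Z).trans hZr, j, hj, hcon⟩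
    exact (hZmin _ hmem).not_gt (Finset.card_erase_lt_of_mem hg)
  let c' : G → ι := fun g => if g ∈ Z then u else if c g = u then r else c g
  have hu' : bundle c' u = Z := by
    ext g
    rw [mem_bundle]
    simp only [c']
    split_ifs with h1 h2
    · simp [h1]
    · simp [h1, hu.symm]
    · simp [h1, h2]
  have hk' : ∀ k, k ≠ r → k ≠ u → bundle c' k = bundle c k := by
    intro k hkr hku
    ext g
    rw [mem_bundle, mem_bundle]
    simp only [c']
    split_ifs with h1 h2
    · simp [hku.symm, mem_bundle.1 (hZr h1), hkr.symm]
    · simp [h2, hku.symm, hkr.symm]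
    · rfl
  have hmono : ∀ j, j ≠ r → val (w j) (bundle c j) ≤ val (w j) (bundle c' j) := by
    intro j hj
    by_cases hju : j = u
    · rw [hju, hu']
      exact hlt.le
    · rw [hk' j hj hju]
  refine ⟨c', fun j hj k hk g hg => le_trans ?_ (hmono j hj), ?_⟩
  · by_cases hku : k = u
    · rw [hku, hu'] at hg ⊢
      exact hZ j hj g hg
    · rw [hk' k hk hku] at hg ⊢
      exact hc j hj k hk g hg
  · refine Finset.sum_lt_sum (fun j hj => hmono j (Finset.ne_of_mem_erase hj)) ⟨u, by simp [hu], ?_⟩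
    rwa [hu']

/-- There is an allocation that is envy-free up to any good between the agents other than `r`,
and in which none of them envies the bundle of `r`. -/
theorem exists_efxOff_no_envy {ι : Type*} [Fintype G] [Fintype ι] (w : ι → G → ℝ) (r : ι) :
    ∃ c : G → ι, EFXOff w r c ∧
      ∀ u, u ≠ r → val (w u) (bundle c r) ≤ val (w u) (bundle c u) := by
  have hinit : EFXOff w r fun _ => r := by
    intro u _ k hk g hg
    exact absurd (mem_bundle.1 hg).symm hk
  obtain ⟨c, hc, hmax⟩ := Finset.exists_max_image (Finset.univ.filter (EFXOff w r))
    (fun c => ∑ u ∈ Finset.univ.erase r, val (w u) (bundle c u)) ⟨_, by simpa using hinit⟩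
  have hc : EFXOff w r c := by simpa using hc
  refine ⟨c, hc, ?_⟩
  by_contra! henvy
  obtain ⟨c', hc', hlt⟩ := hc.exists_improvement henvy
  exact (hmax c' (by simpa using hc')).not_gt hlt

theorem EFXOff.val_univ_le {ι : Type*} [Fintype G] [Fintype ι] [DecidableEq ι]
    {w : ι → G → ℝ} {r : ι}
    {c : G → ι} (hc : EFXOff w r c) {u : ι} (hu : u ≠ r) (hw : ∀ g, 0 ≤ w u g)
    (henvy : val (w u) (bundle c r) ≤ val (w u) (bundle c u)) :
    val (w u) Finset.univ ≤ Fintype.card ι * val (w u) (bundle c u) +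
      ∑ k ∈ (Finset.univ.erase r).erase u, minval (w u) (bundle c k) := by
  have hu_mem : u ∈ Finset.univ.erase r := by simp [hu]
  have hsum : ∑ k ∈ (Finset.univ.erase r).erase u, val (w u) (bundle c k) ≤
      ∑ k ∈ (Finset.univ.erase r).erase u,
        (val (w u) (bundle c u) + minval (w u) (bundle c k)) := by
    refine Finset.sum_le_sum fun k hk => val_le_add_minval (val_nonneg hw _) ?_
    exact hc u hu k (Finset.ne_of_mem_erase (Finset.mem_of_mem_erase hk))
  have hcard : (((Finset.univ.erase r).erase u).card : ℝ) + 2 = Fintype.card ι := by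
    have h1 := Finset.card_erase_add_one hu_mem
    have h2 := Finset.card_erase_add_one (Finset.mem_univ r)
    rw [Finset.card_univ] at h2
    exact_mod_cast (by omega : ((Finset.univ.erase r).erase u).card + 2 = Fintype.card ι)
  rw [Finset.sum_add_distrib, Finset.sum_const, nsmul_eq_mul] at hsum
  rw [← sum_val_bundle (w u) c, ← Finset.sum_erase_add _ _ (Finset.mem_univ r),
    ← Finset.sum_erase_add _ _ hu_mem, ← hcard]
  linarith

/-- Lemma 4: there exists an allocation to `V₂` satisfying (P1). -/
theorem exists_alloc_p1 {G : Type*} [Fintype G] (n : ℕ) (hn : 2 ≤ n)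
    (v : Fin n → G → ℝ) (r : Fin n)
    (hpos : ∀ (i : Fin n) (g : G), 0 ≤ v i g)
    (hnorm : ∀ i : Fin n, val (v i) (Finset.univ : Finset G) = 1) :
    ∃ X : Fin n → Finset G, IsAlloc X ∧ P1 v X r := by
  obtain ⟨m, rfl⟩ : ∃ m, n = m + 1 := ⟨n - 1, by omega⟩
  let σ : Equiv.Perm (Fin (m + 1)) := Equiv.swap (Fin.last m) r
  have hV1 : ∀ i : Fin (m + 1), InV1 i ↔ i ≠ Fin.last m := by
    intro i
    rw [InV1, Nat.add_sub_cancel, ← Fin.lt_last_iff_ne_last, Fin.lt_def, Fin.val_last]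
  have hσ : ∀ i, InV1 i ↔ σ i ≠ r := by
    intro i
    rw [hV1, not_iff_not, ← σ.injective.eq_iff (a := i), Equiv.swap_apply_left]
  obtain ⟨c, hc, henvy⟩ := exists_efxOff_no_envy (fun u => v (σ.symm u)) r
  refine ⟨bundle c, isAlloc_bundle c, σ, σ.injective.injOn,
    fun i hi => ⟨(hσ i).1 hi, ?_⟩, fun u hu => ⟨σ.symm u, (hσ _).2 ?_, ?_⟩⟩
  · have hi := (hσ i).1 hi
    have key := hc.val_univ_le hi (hpos _) (henvy _ hi)
    simp only [Equiv.symm_apply_apply, hnorm, Fintype.card_fin] at key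
    have hs : 0 ≤ ∑ k ∈ (Finset.univ.erase r).erase (σ i), minval (v i) (bundle c k) :=
      Finset.sum_nonneg fun k _ => minval_nonneg (hpos i) _
    have hm : (0 : ℝ) < m := by exact_mod_cast (by omega : 0 < m)
    unfold Edge
    generalize ∑ k ∈ (Finset.univ.erase r).erase (σ i), minval (v i) (bundle c k) = s at key hs ⊢
    push_cast at key ⊢
    rw [add_sub_cancel_right, ge_iff_le, div_le_iff₀ (by positivity)]
    have hms : 1 / (m : ℝ) * s * (m + 1) = s + s / m := by field_simp
    have hdiv : 0 ≤ s / m := by positivity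
    linarith
  · simpa using hu
  · simp
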